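/- Let m, n ∈ ℤ with m + n odd, and let M = [[0,1,n+1],[1,0,m],[0,2,2n+1]] (a matrix in SL(3,ℤ) of Hessenberg type ⟨0,1|1,0,2⟩, with Hessenberg complexity 2). Assume the characteristic polynomial of M is irreducible over ℚ. Then M is a reduced perfect Hessenberg matrix. -/

import Mathlib

open Matrix Polynomial

/-- An n×n integer matrix is (upper) Hessenberg if `M i j = 0` whenever `i > j+1`
(0-based indices). -/
def IsHessenberg {n : ℕ} (M : Matrix (Fin n) (Fin n) ℤ) : Prop :=
  ∀ i j : Fin n, (j : ℕ) + 1 < (i : ℕ) → M i j = 0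

/-- The subdiagonal entry `M (j+1) j` (0-based `j`), or `0` if out of range. -/
def subdiag {n : ℕ} (M : Matrix (Fin n) (Fin n) ℤ) (j : ℕ) : ℤ :=
  if h : j + 1 < n then M ⟨j + 1, h⟩ ⟨j, Nat.lt_of_succ_lt h⟩ else 0

/-- Hessenberg complexity `ς(M) = ∏_{j=1}^{n-1} |M (j+1) j|^(n-j)` (1-based). -/
def hessComplexity {n : ℕ} (M : Matrix (Fin n) (Fin n) ℤ) : ℤ :=
  ∏ j ∈ Finset.range (n - 1), |subdiag M j| ^ (n - 1 - j)

/-- Integer conjugacy: `X * A * X⁻¹ = B` for some `X ∈ GL(n, ℤ)`. -/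
def IntegerConjugate {n : ℕ} (A B : Matrix (Fin n) (Fin n) ℤ) : Prop :=
  ∃ X : Matrix (Fin n) (Fin n) ℤ, IsUnit X.det ∧ X * A = B * X

/-- Perfect Hessenberg matrix: in `SL(n,ℤ)`, Hessenberg, irreducible characteristic
polynomial over ℚ, and `0 ≤ M i j < M (j+1) j` for `1 ≤ i ≤ j ≤ n-1` (1-based). -/
def IsPerfect {n : ℕ} (M : Matrix (Fin n) (Fin n) ℤ) : Prop :=
  M.det = 1 ∧ IsHessenberg M ∧
  Irreducible ((M.charpoly).map (Int.castRingHom ℚ)) ∧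
  ∀ i j : Fin n, i ≤ j → (j : ℕ) + 1 < n → 0 ≤ M i j ∧ M i j < subdiag M (j : ℕ)

/-- A perfect Hessenberg matrix is reduced if its Hessenberg complexity is minimal
among all perfect Hessenberg matrices integer conjugate to it. -/
def IsReducedHess {n : ℕ} (W : Matrix (Fin n) (Fin n) ℤ) : Prop :=
  IsPerfect W ∧ ∀ M : Matrix (Fin n) (Fin n) ℤ, IsPerfect M → IntegerConjugate W M →
    hessComplexity W ≤ hessComplexity M

/-- If `A ^ 2` is the identity modulo `k`, then so is `B ^ 2` for every integer conjugate `B`. -/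
theorem IntegerConjugate.map_sq_eq_one {l : ℕ} {A B : Matrix (Fin l) (Fin l) ℤ} (k : ℕ)
    (h : IntegerConjugate A B) (hA : A.map (Int.castRingHom (ZMod k)) ^ 2 = 1) :
    B.map (Int.castRingHom (ZMod k)) ^ 2 = 1 := by
  obtain ⟨X, hX, hXA⟩ := h
  let f := (Int.castRingHom (ZMod k)).mapMatrix (m := Fin l)
  have hfX : IsUnit (f X) := ((Matrix.isUnit_iff_isUnit_det X).2 hX).map f
  have hf : SemiconjBy (f X) (f A) (f B) := by
    simpa only [SemiconjBy, map_mul] using congrArg f hXA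
  have hsq : f X * f A ^ 2 = f B ^ 2 * f X := hf.pow_right 2
  have hfA : f A ^ 2 = 1 := hA
  rw [hfA, mul_one] at hsq
  exact hfX.mul_right_cancel (by rw [one_mul]; exact hsq.symm)

theorem hessComplexity_fin_three (M : Matrix (Fin 3) (Fin 3) ℤ) :
    hessComplexity M = |M 1 0| ^ 2 * |M 2 1| := by
  simp [hessComplexity, subdiag, Finset.prod_range_succ]

/-- A perfect `3 × 3` Hessenberg matrix whose square is the identity modulo `2` has Hessenberg
complexity at least `2`. -/
theorem IsPerfect.two_le_hessComplexity {M : Matrix (Fin 3) (Fin 3) ℤ} (hM : IsPerfect M)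
    (hsq : M.map (Int.castRingHom (ZMod 2)) ^ 2 = 1) : 2 ≤ hessComplexity M := by
  obtain ⟨-, hH, -, hP⟩ := hM
  have h20 : M 2 0 = 0 := hH 2 0 (by decide)
  have ha : 0 < M 1 0 := by
    have h := hP 0 0 le_rfl (by decide)
    simp only [subdiag] at h
    exact h.1.trans_lt h.2
  have hb : 0 < M 2 1 := by
    have h := hP 1 1 le_rfl (by decide)
    simp only [subdiag] at h
    exact h.1.trans_lt h.2
  have hdvd : (2 : ℤ) ∣ M 2 1 * M 1 0 := by
    have h := congrFun (congrFun hsq 2) 0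
    rw [pow_two, Matrix.mul_apply, Fin.sum_univ_three] at h
    simp only [Matrix.map_apply, h20, map_zero, zero_mul, mul_zero, zero_add, add_zero] at h
    refine (ZMod.intCast_zmod_eq_zero_iff_dvd _ 2).1 ?_
    simpa using h
  have hle : 2 ≤ M 2 1 * M 1 0 := Int.le_of_dvd (mul_pos hb ha) hdvd
  rw [hessComplexity_fin_three, abs_of_pos ha, abs_of_pos hb]
  nlinarith [mul_nonneg (mul_pos hb ha).le (sub_nonneg.2 (Int.add_one_le_of_lt ha))]

/-- for `m + n` odd, the matrix `[[0,1,n+1],[1,0,m],[0,2,2n+1]]` of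
Hessenberg type ⟨0,1|1,0,2⟩ (which lies in `SL(3,ℤ)` and has Hessenberg complexity 2)
is, provided its characteristic polynomial is irreducible over ℚ, a reduced perfect
Hessenberg matrix. -/
theorem statement14 (m n : ℤ) (hodd : Odd (m + n))
    (hirr : Irreducible
      (((!![0, 1, n + 1; 1, 0, m; 0, 2, 2 * n + 1] : Matrix (Fin 3) (Fin 3) ℤ).charpoly).map
        (Int.castRingHom ℚ))) :
    (!![0, 1, n + 1; 1, 0, m; 0, 2, 2 * n + 1] : Matrix (Fin 3) (Fin 3) ℤ).det = 1 ∧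
    hessComplexity (!![0, 1, n + 1; 1, 0, m; 0, 2, 2 * n + 1] : Matrix (Fin 3) (Fin 3) ℤ) = 2 ∧
    IsReducedHess (!![0, 1, n + 1; 1, 0, m; 0, 2, 2 * n + 1] : Matrix (Fin 3) (Fin 3) ℤ) := by
  have hdet : (!![0, 1, n + 1; 1, 0, m; 0, 2, 2 * n + 1] : Matrix (Fin 3) (Fin 3) ℤ).det = 1 := by
    simp [Matrix.det_fin_three]
    ring
  have hς : hessComplexity
      (!![0, 1, n + 1; 1, 0, m; 0, 2, 2 * n + 1] : Matrix (Fin 3) (Fin 3) ℤ) = 2 := by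
    simp [hessComplexity_fin_three]
  refine ⟨hdet, hς, ⟨hdet, ?_, hirr, ?_⟩, fun M hM hconj => ?_⟩
  · intro i j hij
    fin_cases i <;> fin_cases j <;> simp at hij ⊢
  · intro i j hij hj
    fin_cases i <;> fin_cases j <;> simp [subdiag] at hij hj ⊢
  · rw [hς]
    refine hM.two_le_hessComplexity (hconj.map_sq_eq_one 2 ?_)
    have hmn : (m : ZMod 2) = n + 1 := by
      obtain ⟨k, hk⟩ := hodd
      have h : m = n + 1 + 2 * (k - n) := by linarith
      rw [h]
      push_cast
      rw [show (2 : ZMod 2) = 0 from rfl, zero_mul, add_zero]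
    have h2 : (2 : ZMod 2) = 0 := rfl
    ext i j
    fin_cases i <;> fin_cases j <;>
      simp [pow_two, Matrix.mul_apply, Fin.sum_univ_three, hmn, h2, CharTwo.add_self_eq_zero]
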